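/- Every finite subgroup of PGL(2, ℂ) (equivalently, every finite group of automorphisms of ℙ¹) is isomorphic to one of: a cyclic group ℤ/n, a dihedral group of order 2n, the alternating group A₄, the symmetric group S₄, or the alternating group A₅. -/

import Mathlib

open Matrix

section ProjectiveLine

open scoped LinearAlgebra.Projectivization MatrixGroups

/-- A matrix whose image in `PGL(2, ℂ)` has finite order is not parabolic. -/
lemma not_isParabolic_of_isOfFinOrder {g : GL (Fin 2) ℂ}
    (hg : IsOfFinOrder (ProjGenLinGroup.mk g)) : ¬ g.IsParabolic := by
  intro hp
  obtain ⟨n, hn, h⟩ := isOfFinOrder_iff_pow_eq_one.mp hg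
  rw [← map_pow, ProjGenLinGroup.mk_eq_one, GeneralLinearGroup.center_eq_range_scalar] at h
  obtain ⟨u, hu⟩ := h
  refine (hp.pow hn.ne').1 ⟨u, ?_⟩
  rw [← hu]
  simp

/-- A non-scalar, non-parabolic element of `GL(2, ℂ)` has exactly two fixed points on the
projective line. -/
lemma ncard_fixedBy_onePoint {g : GL (Fin 2) ℂ} (hd : g.val.discr ≠ 0) :
    (MulAction.fixedBy (OnePoint ℂ) g).ncard = 2 := by
  rw [discr_fin_two, trace_fin_two, det_fin_two] at hd
  have hfin (z : ℂ) : g • (z : OnePoint ℂ) = z ↔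
      g 1 0 * (z * z) + (g 1 1 - g 0 0) * z + (- g 0 1) = 0 := by
    rw [← GeneralLinearGroup.fixpointPolynomial_aeval_eq_zero_iff]
    simp [GeneralLinearGroup.fixpointPolynomial, sq, sub_eq_add_neg]
  rw [Set.ncard_eq_two]
  by_cases hc : g 1 0 = 0
  · have had : g 1 1 - g 0 0 ≠ 0 := by
      intro h
      apply hd
      simp only [hc]
      linear_combination (g 1 1 - g 0 0) * h
    refine ⟨.infty, ((g 0 1 / (g 1 1 - g 0 0) : ℂ) : OnePoint ℂ), OnePoint.infty_ne_coe _, ?_⟩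
    ext x
    cases x with
    | infty => simp [OnePoint.smul_infty_eq_self_iff, hc]
    | coe z =>
      simp only [MulAction.mem_fixedBy, hfin, hc, Set.mem_insert_iff, OnePoint.coe_ne_infty,
        Set.mem_singleton_iff, OnePoint.coe_eq_coe, false_or, eq_div_iff had]
      grind
  · obtain ⟨s, hs⟩ := IsAlgClosed.exists_pow_nat_eq
      (discrim (g 1 0) (g 1 1 - g 0 0) (- g 0 1)) two_pos
    have hs0 : s ≠ 0 := by
      rintro rfl
      apply hd
      rw [discrim] at hs
      linear_combination -hs
    have hs' : discrim (g 1 0) (g 1 1 - g 0 0) (- g 0 1) = s * s := by rw [← hs, sq]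
    refine ⟨(((-(g 1 1 - g 0 0) + s) / (2 * g 1 0) : ℂ) : OnePoint ℂ),
      (((-(g 1 1 - g 0 0) - s) / (2 * g 1 0) : ℂ) : OnePoint ℂ), ?_, ?_⟩
    · rw [Ne, OnePoint.coe_eq_coe, div_left_inj' (by simp [hc])]
      intro h
      apply hs0
      linear_combination h / 2
    · ext x
      cases x with
      | infty => simp [OnePoint.smul_infty_eq_self_iff, hc]
      | coe z =>
        simp only [MulAction.mem_fixedBy, hfin, quadratic_eq_zero_iff hc hs',
          Set.mem_insert_iff, Set.mem_singleton_iff, OnePoint.coe_eq_coe]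

lemma discr_ne_zero_of_isOfFinOrder {g : GL (Fin 2) ℂ}
    (hg : IsOfFinOrder (ProjGenLinGroup.mk g)) (h1 : ProjGenLinGroup.mk g ≠ 1) :
    g.val.discr ≠ 0 := by
  refine fun h ↦ not_isParabolic_of_isOfFinOrder hg ⟨?_, h⟩
  rintro ⟨a, ha⟩
  apply h1
  rw [ProjGenLinGroup.mk_eq_one, GeneralLinearGroup.mem_center_iff_val_mem_range_scalar]
  exact ⟨a, ha⟩

/-- A nontrivial element of finite order in `PGL(2, ℂ)` has exactly two fixed points on the
projective line. -/
lemma ncard_fixedBy_projectivization {p : PGL(2, ℂ)} (hp : IsOfFinOrder p) (h1 : p ≠ 1) :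
    (MulAction.fixedBy (ℙ ℂ (Fin 2 → ℂ)) p).ncard = 2 := by
  obtain ⟨g, rfl⟩ := ProjGenLinGroup.mk_surjective p
  refine Eq.trans ?_ (ncard_fixedBy_onePoint (discr_ne_zero_of_isOfFinOrder hp h1))
  rw [← Set.ncard_image_of_injective _ (OnePoint.equivProjectivization ℂ).injective]
  congr 1
  ext x
  obtain ⟨y, rfl⟩ := (OnePoint.equivProjectivization ℂ).surjective x
  rw [(OnePoint.equivProjectivization ℂ).injective.mem_set_image, MulAction.mem_fixedBy,
    MulAction.mem_fixedBy, ← (OnePoint.equivProjectivization ℂ).injective.eq_iff,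
    OnePoint.equivProjectivization_smul]
  rfl

/-- If a matrix in `GL(2, ℂ)` has an eigenvalue whose square is the determinant, then its
discriminant vanishes. -/
lemma discr_eq_zero_of_eigenvalue_sq_eq_det {g : GL (Fin 2) ℂ} {v : Fin 2 → ℂ} (hv : v ≠ 0) {a : ℂ}
    (ha : g • v = a • v) (hdet : a ^ 2 = g.val.det) : g.val.discr = 0 := by
  have h : (g.val - a • 1).det = 0 := by
    rw [← exists_mulVec_eq_zero_iff]
    refine ⟨v, hv, ?_⟩
    rw [sub_mulVec, smul_mulVec, one_mulVec, ← ha]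
    exact sub_self _
  rw [det_fin_two] at hdet
  rw [discr_fin_two, trace_fin_two, det_fin_two]
  simp [det_fin_two] at h
  have ha0 : a * (2 * a - (g 0 0 + g 1 1)) = 0 := by linear_combination h + hdet
  rcases mul_eq_zero.mp ha0 with h0 | h0
  · exact absurd (by rw [det_fin_two, ← hdet, h0]; simp) g.det_ne_zero
  · linear_combination (-(g 0 0 + g 1 1) - 2 * a) * h0 + 4 * hdet

/-- The stabilizer of a point of the projective line in a finite subgroup of `PGL(2, ℂ)` is
cyclic. -/
lemma isCyclic_stabilizer_projectivization (G : Subgroup PGL(2, ℂ)) [Finite G]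
    (x : ℙ ℂ (Fin 2 → ℂ)) : IsCyclic (MulAction.stabilizer G x) := by
  induction x using Projectivization.ind with | h v hv
  have key (p : MulAction.stabilizer G (Projectivization.mk ℂ v hv)) :
      ∃ (g : GL (Fin 2) ℂ) (a : ℂ), ProjGenLinGroup.mk g = p.1.1 ∧ g • v = a • v := by
    obtain ⟨g, hg⟩ := ProjGenLinGroup.mk_surjective p.1.1
    have h : ProjGenLinGroup.mk g • Projectivization.mk ℂ v hv = Projectivization.mk ℂ v hv := by
      rw [hg]; exact p.2
    rw [Projectivization.PGL.mk_smul_mk, Projectivization.mk_eq_mk_iff'] at h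
    obtain ⟨a, ha⟩ := h
    exact ⟨g, a, hg, ha.symm⟩
  choose g a hg ha using key
  have hdet (g : GL (Fin 2) ℂ) : g.val.det ≠ 0 := g.det_ne_zero
  have indep {g g' : GL (Fin 2) ℂ} {a a' : ℂ}
      (h : ProjGenLinGroup.mk g = ProjGenLinGroup.mk g') (hga : g • v = a • v)
      (hga' : g' • v = a' • v) : a ^ 2 / g.val.det = a' ^ 2 / g'.val.det := by
    obtain ⟨u, rfl⟩ := ProjGenLinGroup.mk_eq_mk_iff.mp h
    have hu : (GeneralLinearGroup.scalar (Fin 2) u) • v = (u : ℂ) • v := by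
      simp [Units.smul_def, smul_eq_mulVec]
    rw [mul_smul, hu, smul_comm, hga, smul_smul] at hga'
    have : a' = u * a := (smul_left_injective ℂ hv hga').symm
    rw [this]
    have hdu : ((g * GeneralLinearGroup.scalar (Fin 2) u).val).det = g.val.det * (u : ℂ) ^ 2 := by
      simp [Units.val_mul, det_mul, det_fin_two, sq]
    rw [hdu, div_eq_div_iff (hdet g) (mul_ne_zero (hdet g) (by simp))]
    ring
  let χ : MulAction.stabilizer G (Projectivization.mk ℂ v hv) →* ℂ :=
    { toFun := fun p ↦ a p ^ 2 / (g p).val.det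
      map_one' := by
        rw [indep (g' := 1) (a' := 1) (by simp [hg]) (ha 1) (by simp)]
        simp
      map_mul' := fun p q ↦ by
        rw [indep (g' := g p * g q) (a' := a p * a q) (by simp [hg]) (ha _)
          (by rw [mul_smul, ha, smul_comm, ha, smul_smul, mul_comm])]
        rw [Units.val_mul, det_mul]
        field_simp }
  refine isCyclic_of_injective_ringHom χ ((injective_iff_map_eq_one χ).mpr fun p hp ↦ ?_)
  have h2 : a p ^ 2 = (g p).val.det := by
    rwa [← div_eq_one_iff_eq (hdet _)]
  by_contra hne
  refine discr_ne_zero_of_isOfFinOrder (g := g p) ?_ ?_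
    (discr_eq_zero_of_eigenvalue_sq_eq_det hv (ha p) h2)
  · rw [hg]
    exact G.subtype.isOfFinOrder (isOfFinOrder_of_finite p.1)
  · rw [hg]
    exact fun h ↦ hne (Subtype.ext (Subtype.ext h))

end ProjectiveLine

section TwoFixedPoints

open MulAction

variable {G X : Type*} [Group G] [MulAction G X]

lemma card_stabilizer_eq_of_mem_orbit {x y : X} (h : x ∈ orbit G y) :
    Nat.card (stabilizer G x) = Nat.card (stabilizer G y) := by
  obtain ⟨g, rfl⟩ := h
  exact Nat.card_congr (stabilizerEquivStabilizer (g := g) (a := y) (b := g • y) rfl).symm.toEquiv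

variable (G X) in
/-- The points with nontrivial stabilizer. -/
def nonfreePoints : SubMulAction G X where
  carrier := {x | stabilizer G x ≠ ⊥}
  smul_mem' g x hx := by
    rw [Set.mem_ofPred_eq, stabilizer_smul_eq_stabilizer_map_conj, Ne,
      Subgroup.map_eq_bot_iff_of_injective _ (MulAut.conj g).injective]
    exact hx

lemma mem_nonfreePoints {x : X} : x ∈ nonfreePoints G X ↔ ∃ g : G, g ≠ 1 ∧ g • x = x := by
  change stabilizer G x ≠ ⊥ ↔ _
  simp [Subgroup.ne_bot_iff_exists_ne_one, Subtype.exists, and_comm]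

lemma image_fixedBy_nonfreePoints {g : G} (hg : g ≠ 1) :
    Subtype.val '' (fixedBy (nonfreePoints G X) g) = fixedBy X g := by
  ext x
  constructor
  · rintro ⟨y, hy, rfl⟩
    exact congrArg Subtype.val hy
  · exact fun hx ↦ ⟨⟨x, mem_nonfreePoints.mpr ⟨g, hg, hx⟩⟩, Subtype.ext hx, rfl⟩

variable [Finite G]

/-- A normal subgroup of prime order forces a small orbit if nontrivial elements have exactly two
fixed points. -/
lemma exists_card_le_two_mul_card_stabilizer
    (hfix : ∀ g : G, g ≠ 1 → (fixedBy X g).ncard = 2) (H : Subgroup G) [H.Normal]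
    (hH : (Nat.card H).Prime) :
    ∃ x : X, Nat.card G ≤ 2 * Nat.card (stabilizer G x) := by
  have : Fact (Nat.card H).Prime := ⟨hH⟩
  have : Nontrivial H := Finite.one_lt_card_iff_nontrivial.mp hH.one_lt
  obtain ⟨h, hh⟩ := exists_ne (1 : H)
  have hh' : (h : G) ≠ 1 := by simpa using hh
  have hfin : (fixedBy X (h : G)).Finite := Set.finite_of_ncard_ne_zero (by simp [hfix _ hh'])
  have heq (k : H) (hk : k ≠ 1) : fixedBy X (h : G) = fixedBy X (k : G) := by
    obtain ⟨n, rfl⟩ : k ∈ Subgroup.zpowers h := by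
      rw [zpowers_eq_top_of_prime_card rfl hh]; trivial
    refine Set.eq_of_subset_of_ncard_le ?_ ?_ (Set.finite_of_ncard_ne_zero ?_)
    · simpa using fixedBy_subset_fixedBy_zpow X (h : G) n
    all_goals rw [hfix _ (by simpa only [ne_eq, OneMemClass.coe_eq_one] using hk)]
    · rw [hfix _ hh']
    · simp
  obtain ⟨x, y, hxy, hs⟩ := Set.ncard_eq_two.mp (hfix _ hh')
  have hx : x ∈ fixedBy X (h : G) := by simp [hs]
  refine ⟨x, ?_⟩
  rw [← (stabilizer G x).index_mul_card, index_stabilizer]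
  refine Nat.mul_le_mul_right _ ?_
  rw [← hfix _ hh']
  refine Set.ncard_le_ncard ?_ hfin
  rintro _ ⟨g, rfl⟩
  let k : H := ⟨g⁻¹ * h * g, by simpa using Subgroup.Normal.conj_mem ‹_› _ h.2 g⁻¹⟩
  have hk : k ≠ 1 := by
    intro hk
    apply hh'
    have : g⁻¹ * h * g = 1 := congrArg Subtype.val hk
    rw [mul_assoc, inv_mul_eq_one] at this
    simpa using this
  rw [heq k hk] at hx
  have h2 : (g⁻¹ * h * g) • x = x := hx
  rwa [mul_smul, mul_smul, inv_smul_eq_iff] at h2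

lemma finite_nonfreePoints (hfix : ∀ g : G, g ≠ 1 → (fixedBy X g).ncard = 2) :
    Finite (nonfreePoints G X) := by
  have : (⋃ g : {g : G // g ≠ 1}, fixedBy X g.1).Finite :=
    Set.finite_iUnion fun g ↦ Set.finite_of_ncard_ne_zero (by simp [hfix _ g.2])
  refine (this.subset fun x hx ↦ ?_).to_subtype
  obtain ⟨g, hg, hx⟩ := mem_nonfreePoints.mp hx
  exact Set.mem_iUnion.mpr ⟨⟨g, hg⟩, hx⟩

/-- Burnside's count for actions in which every nontrivial element has two fixed points. -/
lemma card_nonfreePoints_add (hfix : ∀ g : G, g ≠ 1 → (fixedBy X g).ncard = 2) :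
    Nat.card (nonfreePoints G X) + 2 * (Nat.card G - 1) =
      Nat.card (Quotient (orbitRel G (nonfreePoints G X))) * Nat.card G := by
  classical
  have := finite_nonfreePoints hfix
  have := Fintype.ofFinite G
  have := Fintype.ofFinite (nonfreePoints G X)
  have h := sum_card_fixedBy_eq_card_orbits_mul_card_group G (nonfreePoints G X)
  simp only [← Nat.card_eq_fintype_card] at h
  rw [← h, ← Finset.add_sum_erase _ _ (Finset.mem_univ 1)]
  congr 1
  · simp
  · rw [Finset.sum_congr rfl (g := fun _ ↦ 2), Finset.sum_const, Finset.card_erase_of_mem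
      (Finset.mem_univ _), Finset.card_univ, Nat.card_eq_fintype_card, smul_eq_mul, mul_comm]
    intro g hg
    have hg1 := Finset.ne_of_mem_erase hg
    rw [Nat.card_coe_set_eq, ← Set.ncard_image_of_injective _ Subtype.val_injective,
      image_fixedBy_nonfreePoints hg1, hfix g hg1]

lemma two_le_card_stabilizer {x : X} (hx : x ∈ nonfreePoints G X) :
    2 ≤ Nat.card (stabilizer G x) :=
  (Subgroup.one_lt_card_iff_ne_bot _).mpr hx

lemma card_nonfreePoints_eq_sum (hfix : ∀ g : G, g ≠ 1 → (fixedBy X g).ncard = 2)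
    [Fintype (Quotient (orbitRel G (nonfreePoints G X)))] :
    Nat.card (nonfreePoints G X) =
      ∑ ω : Quotient (orbitRel G (nonfreePoints G X)),
        Nat.card G / Nat.card (stabilizer G (ω.out : X)) := by
  classical
  have := finite_nonfreePoints hfix
  have := Fintype.ofFinite G
  have := Fintype.ofFinite (nonfreePoints G X)
  have h := card_eq_sum_card_group_div_card_stabilizer G (nonfreePoints G X)
  simp only [← Nat.card_eq_fintype_card, SubMulAction.stabilizer_of_subMul] at h
  exact h

/-- If every nontrivial element has two fixed points, then either the group fixes a point, or
there are three orbits with nontrivial stabilizers. -/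
lemma exists_stabilizer_eq_top_or_exists_three_orbits [Nontrivial G]
    (hfix : ∀ g : G, g ≠ 1 → (fixedBy X g).ncard = 2) :
    (∃ x : X, stabilizer G x = ⊤) ∨
    ∃ x y z : X, (∀ w, stabilizer G w ≠ ⊥ → w ∈ orbit G x ∨ w ∈ orbit G y ∨ w ∈ orbit G z) ∧
      2 ≤ Nat.card (stabilizer G x) ∧ 2 ≤ Nat.card (stabilizer G y) ∧
      2 ≤ Nat.card (stabilizer G z) ∧
      Nat.card G / Nat.card (stabilizer G x) + Nat.card G / Nat.card (stabilizer G y) +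
        Nat.card G / Nat.card (stabilizer G z) = Nat.card G + 2 := by
  have := finite_nonfreePoints hfix
  have := Fintype.ofFinite (Quotient (orbitRel G (nonfreePoints G X)))
  have h1 := card_nonfreePoints_add hfix
  have h2 := card_nonfreePoints_eq_sum hfix
  have hN : 1 < Nat.card G := Finite.one_lt_card
  have hle : Nat.card (nonfreePoints G X) ≤
      Nat.card (Quotient (orbitRel G (nonfreePoints G X))) * (Nat.card G / 2) := by
    rw [h2, Nat.card_eq_fintype_card (α := Quotient _), ← smul_eq_mul, ← Finset.card_univ]
    exact Finset.sum_le_card_nsmul _ _ _ fun ω _ ↦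
      Nat.div_le_div_left (two_le_card_stabilizer ω.out.2) two_pos
  obtain ⟨g, hg⟩ := exists_ne (1 : G)
  have hge : 2 ≤ Nat.card (nonfreePoints G X) := by
    rw [← hfix g hg, ← image_fixedBy_nonfreePoints hg,
      Set.ncard_image_of_injective _ Subtype.val_injective]
    exact Set.ncard_le_card _
  generalize hk : Nat.card (Quotient (orbitRel G (nonfreePoints G X))) = k at *
  have hk2 : 2 ≤ k := by
    by_contra! hlt
    have : k * Nat.card G ≤ 1 * Nat.card G := Nat.mul_le_mul_right _ (by omega)
    omega
  have hk3 : k ≤ 3 := by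
    have h5 : k * (Nat.card G / 2) * 2 ≤ k * Nat.card G := by
      rw [mul_assoc]; exact Nat.mul_le_mul_left _ (Nat.div_mul_le_self _ _)
    by_contra! hlt
    have : 4 * Nat.card G ≤ k * Nat.card G := Nat.mul_le_mul_right _ hlt
    omega
  rw [Nat.card_eq_fintype_card] at hk
  interval_cases k
  · left
    obtain ⟨e⟩ : Nonempty (Quotient (orbitRel G (nonfreePoints G X)) ≃ Fin 2) :=
      ⟨Fintype.equivFinOfCardEq hk⟩
    have h3 : Nat.card (nonfreePoints G X) = 2 := by omega
    rw [h3, ← e.symm.sum_comp, Fin.sum_univ_two] at h2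
    refine ⟨(e.symm 0).out, ?_⟩
    have hpos (w : X) : 0 < Nat.card G / Nat.card (stabilizer G w) :=
      Nat.div_pos (Subgroup.card_le_card_group _) Nat.card_pos
    have h4 : Nat.card G / Nat.card (stabilizer G ((e.symm 0).out : X)) = 1 := by
      have := hpos (e.symm 0).out
      have := hpos (e.symm 1).out
      omega
    exact Subgroup.eq_top_of_card_eq _ (Nat.eq_of_dvd_of_div_eq_one
      (Subgroup.card_subgroup_dvd_card _) h4)
  · right
    obtain ⟨e⟩ : Nonempty (Quotient (orbitRel G (nonfreePoints G X)) ≃ Fin 3) :=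
      ⟨Fintype.equivFinOfCardEq hk⟩
    rw [← e.symm.sum_comp, Fin.sum_univ_three] at h2
    refine ⟨(e.symm 0).out, (e.symm 1).out, (e.symm 2).out, fun w hw ↦ ?_,
      two_le_card_stabilizer (e.symm 0).out.2, two_le_card_stabilizer (e.symm 1).out.2,
      two_le_card_stabilizer (e.symm 2).out.2, by omega⟩
    let w' : nonfreePoints G X := ⟨w, hw⟩
    let ω : Quotient (orbitRel G (nonfreePoints G X)) := Quotient.mk _ w'
    have key (i : Fin 3) (hi : e ω = i) : w ∈ orbit G ((e.symm i).out : X) := by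
      subst hi
      have : w' ∈ orbit G ω.out :=
        orbitRel_apply.mp ((orbitRel G _).symm (@Quotient.mk_out _ (orbitRel G _) w'))
      obtain ⟨g, hg⟩ := this
      refine ⟨g, ?_⟩
      simpa using congrArg Subtype.val hg
    have : e ω = 0 ∨ e ω = 1 ∨ e ω = 2 := by
      generalize e ω = i
      fin_cases i <;> simp
    exact this.imp (key 0) (Or.imp (key 1) (key 2))

/-- The solutions of `1/a + 1/b + 1/c = 1 + 2/N` in divisors `2 ≤ a ≤ b ≤ c` of `N`. -/
lemma platonic_triples {N a b c : ℕ} (ha : a ∣ N) (hb : b ∣ N) (hc : c ∣ N)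
    (ha2 : 2 ≤ a) (hab : a ≤ b) (hbc : b ≤ c) (h : N / a + N / b + N / c = N + 2) :
    (a = 2 ∧ b = 2 ∧ N = 2 * c) ∨ (a = 2 ∧ b = 3 ∧ c = 3 ∧ N = 12) ∨
      (a = 2 ∧ b = 3 ∧ c = 4 ∧ N = 24) ∨ (a = 2 ∧ b = 3 ∧ c = 5 ∧ N = 60) := by
  obtain ⟨p, hp⟩ := ha
  obtain ⟨q, hq⟩ := hb
  obtain ⟨r, hr⟩ := hc
  rw [Nat.div_eq_of_eq_mul_right (by omega) hp, Nat.div_eq_of_eq_mul_right (by omega) hq,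
    Nat.div_eq_of_eq_mul_right (by omega) hr] at h
  have ha3 : a < 3 := by
    by_contra! hlt
    have := Nat.mul_le_mul_right p hlt
    have := Nat.mul_le_mul_right q (hlt.trans hab)
    have := Nat.mul_le_mul_right r (hlt.trans (hab.trans hbc))
    omega
  obtain rfl : a = 2 := by omega
  have hb4 : b < 4 := by
    by_contra! hlt
    have := Nat.mul_le_mul_right q hlt
    have := Nat.mul_le_mul_right r (hlt.trans hbc)
    omega
  interval_cases b
  · left
    obtain rfl : r = 2 := by omega
    omega
  · right
    have hc6 : c < 6 := by
      by_contra! hlt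
      have := Nat.mul_le_mul_right r hlt
      omega
    interval_cases c <;> omega

/-- The orbit data of a finite group acting without a global fixed point such that every
nontrivial element has exactly two fixed points. -/
lemma exists_stabilizer_eq_top_or_platonic [Nontrivial G]
    (hfix : ∀ g : G, g ≠ 1 → (fixedBy X g).ncard = 2) :
    (∃ x : X, stabilizer G x = ⊤) ∨
    ∃ x y z : X, (∀ w, stabilizer G w ≠ ⊥ → w ∈ orbit G x ∨ w ∈ orbit G y ∨ w ∈ orbit G z) ∧
      Nat.card (stabilizer G x) = 2 ∧
      ((Nat.card (stabilizer G y) = 2 ∧ Nat.card G = 2 * Nat.card (stabilizer G z)) ∨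
      (Nat.card (stabilizer G y) = 3 ∧ Nat.card (stabilizer G z) = 3 ∧ Nat.card G = 12) ∨
      (Nat.card (stabilizer G y) = 3 ∧ Nat.card (stabilizer G z) = 4 ∧ Nat.card G = 24) ∨
      (Nat.card (stabilizer G y) = 3 ∧ Nat.card (stabilizer G z) = 5 ∧ Nat.card G = 60)) := by
  refine (exists_stabilizer_eq_top_or_exists_three_orbits hfix).imp id ?_
  rintro ⟨x, y, z, hcov, hx, hy, hz, hsum⟩
  suffices ∃ x y z : X,
      (∀ w, stabilizer G w ≠ ⊥ → w ∈ orbit G x ∨ w ∈ orbit G y ∨ w ∈ orbit G z) ∧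
      2 ≤ Nat.card (stabilizer G x) ∧
      Nat.card (stabilizer G x) ≤ Nat.card (stabilizer G y) ∧
      Nat.card (stabilizer G y) ≤ Nat.card (stabilizer G z) ∧
      Nat.card G / Nat.card (stabilizer G x) + Nat.card G / Nat.card (stabilizer G y) +
        Nat.card G / Nat.card (stabilizer G z) = Nat.card G + 2 by
    obtain ⟨x, y, z, hcov, hx, hxy, hyz, hsum⟩ := this
    have h := platonic_triples (stabilizer G x).card_subgroup_dvd_card
      (stabilizer G y).card_subgroup_dvd_card (stabilizer G z).card_subgroup_dvd_card
      hx hxy hyz hsum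
    exact ⟨x, y, z, hcov, by omega, by omega⟩
  rcases le_total (Nat.card (stabilizer G x)) (Nat.card (stabilizer G y)) with h1 | h1 <;>
  rcases le_total (Nat.card (stabilizer G y)) (Nat.card (stabilizer G z)) with h2 | h2 <;>
  rcases le_total (Nat.card (stabilizer G x)) (Nat.card (stabilizer G z)) with h3 | h3
  · exact ⟨x, y, z, hcov, hx, h1, h2, hsum⟩
  · exact ⟨x, y, z, hcov, hx, h1, h2, hsum⟩
  · exact ⟨x, z, y, fun w hw ↦ by have := hcov w hw; tauto, hx, h3, h2, by omega⟩
  · exact ⟨z, x, y, fun w hw ↦ by have := hcov w hw; tauto, hz, h3, h1, by omega⟩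
  · exact ⟨y, x, z, fun w hw ↦ by have := hcov w hw; tauto, hy, h1, h3, by omega⟩
  · exact ⟨y, z, x, fun w hw ↦ by have := hcov w hw; tauto, hy, h2, h3, by omega⟩
  · exact ⟨z, y, x, fun w hw ↦ by have := hcov w hw; tauto, hz, h2, h1, by omega⟩
  · exact ⟨z, y, x, fun w hw ↦ by have := hcov w hw; tauto, hz, h2, h1, by omega⟩

end TwoFixedPoints

section Recognition

variable {G : Type*} [Group G]

open DihedralGroup in
/-- Recognition of dihedral groups: an abelian-by-inversion group of order `2n`. -/
lemma nonempty_mulEquiv_dihedralGroup [Finite G] (C : Subgroup G) (hC : IsCyclic C)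
    (hcard : Nat.card G = 2 * Nat.card C) (hsq : ∀ g ∉ C, g * g = 1) :
    Nonempty (G ≃* DihedralGroup (Nat.card C)) := by
  have hpos : 0 < Nat.card C := Nat.card_pos
  obtain ⟨s, hs⟩ : ∃ s, s ∉ C := by
    by_contra! h
    have : C = ⊤ := (Subgroup.eq_top_iff' C).mpr h
    rw [this, Subgroup.card_top] at hcard hpos
    omega
  have hss := hsq s hs
  let e := zmodCyclicMulEquiv hC
  let c (i : ZMod (Nat.card C)) : G := e (Multiplicative.ofAdd i)
  have hmem (i) : c i ∈ C := (e (Multiplicative.ofAdd i)).2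
  have hadd (i j) : c (i + j) = c i * c j := by simp [c, ofAdd_add]
  have hsub (i j) : c (j - i) = (c i)⁻¹ * c j := by
    rw [eq_inv_mul_iff_mul_eq, ← hadd, add_sub_cancel]
  have hinv (i) : c i * s = s * (c i)⁻¹ := by
    have h := hsq (s * c i) fun h ↦ hs ((C.mul_mem_cancel_right (hmem i)).mp h)
    rw [eq_mul_inv_iff_mul_eq, ← mul_right_inj s, hss]
    simpa only [mul_assoc] using h
  let f : DihedralGroup (Nat.card C) →* G := MonoidHom.mk' (fun x ↦ match x with
    | r i => c i
    | sr i => s * c i) (by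
      rintro (i | i) (j | j)
      · exact hadd i j
      · simp only [r_mul_sr, hsub, ← mul_assoc, hinv]
      · simp only [sr_mul_r, hadd, mul_assoc]
      · simp only [sr_mul_sr, hsub]
        rw [mul_assoc s (c i), ← mul_assoc (c i) s, hinv, mul_assoc s, ← mul_assoc s s, hss, one_mul])
  have hf : Function.Injective f := by
    rw [injective_iff_map_eq_one]
    rintro (i | i) h
    · have h : c i = 1 := h
      have : e (Multiplicative.ofAdd i) = 1 := Subtype.ext h
      rw [e.map_eq_one_iff, ofAdd_eq_one] at this
      rw [this, r_zero]
    · have h : s * c i = 1 := h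
      exact absurd ((C.mul_mem_cancel_right (hmem i)).mp (h ▸ C.one_mem)) hs
  exact ⟨(MulEquiv.ofBijective f ((Nat.bijective_iff_injective_and_card f).mpr
    ⟨hf, by rw [nat_card, hcard]⟩)).symm⟩

lemma nonempty_mulEquiv_perm_of_injective [Finite G] {α : Type*} [Finite α] {f : G →* Equiv.Perm α}
    (hf : Function.Injective f) {n : ℕ} (hα : Nat.card α = n) (h : Nat.card G = n.factorial) :
    Nonempty (G ≃* Equiv.Perm (Fin n)) := by
  subst hα
  exact ⟨(MulEquiv.ofBijective f ((Nat.bijective_iff_injective_and_card f).mpr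
    ⟨hf, by rw [h, Nat.card_perm]⟩)).trans (Finite.equivFin α).permCongrHom⟩

lemma nonempty_mulEquiv_alternatingGroup_of_injective {α : Type*} [Finite α]
    {f : G →* Equiv.Perm α} (hf : Function.Injective f) {n : ℕ} (hα : Nat.card α = n)
    (h : 2 * Nat.card G = n.factorial) : Nonempty (G ≃* alternatingGroup (Fin n)) := by
  subst hα
  classical
  have := Fintype.ofFinite α
  have hcard : Nat.card f.range = Nat.card G := Nat.card_congr (f.ofInjective hf).symm.toEquiv
  have hindex : f.range.index = 2 := by
    have h1 := f.range.card_mul_index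
    have h2 : 0 < Nat.card G := by have := (Nat.card α).factorial_pos; omega
    rw [Nat.card_perm, ← h, hcard, mul_comm 2] at h1
    exact Nat.eq_of_mul_eq_mul_left h2 h1
  exact ⟨((f.ofInjective hf).trans (MulEquiv.subgroupCongr
    (Equiv.Perm.eq_alternatingGroup_of_index_eq_two hindex))).trans
    (Finite.equivFin α).altCongrHom⟩

lemma card_sylow_eq_pow [Finite G] {p k m : ℕ} [hp : Fact p.Prime] (P : Sylow p G)
    (h : Nat.card G = p ^ k * m) (hm : ¬ p ∣ m) : Nat.card P = p ^ k := by
  have hm0 : m ≠ 0 := by rintro rfl; exact hm (dvd_zero p)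
  rw [P.card_eq_multiplicity, h, Nat.factorization_mul (pow_ne_zero k hp.out.ne_zero) hm0]
  simp [hp.out.factorization_self, Nat.factorization_eq_zero_of_not_dvd hm]

lemma ker_toPermHom_sylow_le_normalizer {p : ℕ} (P : Sylow p G) :
    (MulAction.toPermHom G (Sylow p G)).ker ≤ Subgroup.normalizer P := by
  intro g hg
  rw [← Sylow.smul_eq_iff_mem_normalizer]
  exact congrArg (· P) (MonoidHom.mem_ker.mp hg)

lemma card_ker_toPermHom_sylow_dvd [Finite G] {p : ℕ} [Fact p.Prime] :
    Nat.card (MulAction.toPermHom G (Sylow p G)).ker * Nat.card (Sylow p G) ∣ Nat.card G := by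
  obtain ⟨P⟩ : Nonempty (Sylow p G) := inferInstance
  rw [← (Subgroup.normalizer (P : Set G)).card_mul_index, ← Sylow.card_eq_index_normalizer]
  exact Nat.mul_dvd_mul_right (Subgroup.card_dvd_of_le (ker_toPermHom_sylow_le_normalizer P)) _

/-- If a Sylow `p`-subgroup has order `p` and is not normal, then the kernel of the conjugation
action on the Sylow `p`-subgroups has order prime to `p`. -/
lemma not_dvd_card_ker_toPermHom_sylow [Finite G] {p : ℕ} [Fact p.Prime]
    (hP : ∀ P : Sylow p G, Nat.card P = p) (h1 : Nat.card (Sylow p G) ≠ 1) :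
    ¬ p ∣ Nat.card (MulAction.toPermHom G (Sylow p G)).ker := by
  intro hdvd
  obtain ⟨k, hk⟩ := exists_prime_orderOf_dvd_card' p hdvd
  have hk' : Nat.card (Subgroup.zpowers (k : G)) = p := by
    rw [Nat.card_zpowers, Subgroup.orderOf_coe, hk]
  have hp : IsPGroup p (Subgroup.zpowers (k : G)) := IsPGroup.of_card (n := 1) (by simpa)
  have hle (P : Sylow p G) : (P : Subgroup G) = Subgroup.zpowers (k : G) := by
    symm
    refine Subgroup.eq_of_le_of_card_ge ?_ (by rw [hk']; exact (hP P).le)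
    rw [← inf_eq_left, ← hp.inf_normalizer_sylow P, inf_eq_left, Subgroup.zpowers_le]
    exact ker_toPermHom_sylow_le_normalizer P k.2
  have : Subsingleton (Sylow p G) := ⟨fun P Q ↦ Sylow.ext ((hle P).trans (hle Q).symm)⟩
  exact h1 (Nat.card_eq_one_iff_unique.mpr ⟨this, inferInstance⟩)

/-- A group of order 12 or 24 without normal subgroups of prime order acts faithfully on its four
Sylow 3-subgroups. -/
lemma injective_toPermHom_sylow_three [Finite G] (hG : Nat.card G = 12 ∨ Nat.card G = 24)
    (hn : ∀ H : Subgroup G, H.Normal → ¬ (Nat.card H).Prime) :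
    Nat.card (Sylow 3 G) = 4 ∧ Function.Injective (MulAction.toPermHom G (Sylow 3 G)) := by
  have hP (P : Sylow 3 G) : Nat.card P = 3 := by
    rcases hG with hG | hG
    · exact card_sylow_eq_pow (k := 1) (m := 4) P hG (by norm_num)
    · exact card_sylow_eq_pow (k := 1) (m := 8) P hG (by norm_num)
  obtain ⟨P⟩ : Nonempty (Sylow 3 G) := inferInstance
  have h1 : Nat.card (Sylow 3 G) ≠ 1 := by
    intro h
    have := (Nat.card_eq_one_iff_unique.mp h).1
    exact hn P inferInstance (by rw [hP P]; exact Nat.prime_three)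
  have hmod := card_sylow_modEq_one 3 G
  have hdvd := P.card_dvd_index
  have hmul := (P : Subgroup G).card_mul_index
  rw [hP P] at hmul
  have h4 : Nat.card (Sylow 3 G) = 4 := by
    have hle := Nat.le_of_dvd (by omega) hdvd
    have h8 : (P : Subgroup G).index ∣ 8 := by
      rcases hG with hG | hG
      · rw [show (P : Subgroup G).index = 4 by omega]; norm_num
      · rw [show (P : Subgroup G).index = 8 by omega]
    obtain ⟨m, hm, h2⟩ := (Nat.dvd_prime_pow Nat.prime_two (m := 3)).mp (hdvd.trans h8)
    rw [h2] at hmod h1 ⊢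
    interval_cases m <;> simp_all [Nat.ModEq]
  refine ⟨h4, ?_⟩
  rw [← MonoidHom.ker_eq_bot_iff, ← Subgroup.card_eq_one]
  have h3 := not_dvd_card_ker_toPermHom_sylow hP h1
  have hk := card_ker_toPermHom_sylow_dvd (G := G) (p := 3)
  have h2 := hn _ (MulAction.toPermHom G (Sylow 3 G)).normal_ker
  rw [h4] at hk
  have h6 : Nat.card (MulAction.toPermHom G (Sylow 3 G)).ker ∣ 6 := by
    refine Nat.dvd_of_mul_dvd_mul_right (k := 4) (by norm_num) (hk.trans ?_)
    rcases hG with hG | hG <;> rw [hG]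
    norm_num
  generalize Nat.card (MulAction.toPermHom G (Sylow 3 G)).ker = k at h2 h3 h6
  have := Nat.le_of_dvd (by norm_num) h6
  interval_cases k <;> simp_all +decide

lemma nonempty_mulEquiv_alternatingGroup_four [Finite G] (hG : Nat.card G = 12)
    (hn : ∀ H : Subgroup G, H.Normal → ¬ (Nat.card H).Prime) :
    Nonempty (G ≃* alternatingGroup (Fin 4)) := by
  obtain ⟨h4, hinj⟩ := injective_toPermHom_sylow_three (.inl hG) hn
  exact nonempty_mulEquiv_alternatingGroup_of_injective hinj h4 (by rw [hG]; rfl)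

lemma nonempty_mulEquiv_perm_four [Finite G] (hG : Nat.card G = 24)
    (hn : ∀ H : Subgroup G, H.Normal → ¬ (Nat.card H).Prime) :
    Nonempty (G ≃* Equiv.Perm (Fin 4)) := by
  obtain ⟨h4, hinj⟩ := injective_toPermHom_sylow_three (.inr hG) hn
  exact nonempty_mulEquiv_perm_of_injective hinj h4 (by rw [hG]; rfl)

lemma ncard_conjugatesOf_mul_card_centralizer [Finite G] (t : G) :
    (conjugatesOf t).ncard * Nat.card (Subgroup.centralizer {t}) = Nat.card G := by
  rw [Subgroup.nat_card_centralizer_nat_card_stabilizer, mul_comm]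
  have h := (MulAction.stabilizer (ConjAct G) t).card_mul_index
  rw [MulAction.index_stabilizer, ConjAct.orbit_eq_carrier_conjClasses] at h
  exact h

/-- The number of involutions when the Sylow 2-subgroups are the centralizers of involutions. -/
lemma card_sylow_two_mul_three [Finite G] (hcard : ∀ P : Sylow 2 G, Nat.card P = 4)
    (h4 : ∀ g : G, orderOf g ≠ 4)
    (hcent : ∀ t : G, orderOf t = 2 → Nat.card (Subgroup.centralizer {t}) ≤ 4) :
    Nat.card (Sylow 2 G) * 3 = {t : G | orderOf t = 2}.ncard := by
  have key (P : Sylow 2 G) (t : G) (ht : t ∈ P) (h1 : t ≠ 1) :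
      orderOf t = 2 ∧ (P : Subgroup G) = Subgroup.centralizer {t} := by
    have ho : orderOf t = 2 := by
      have hd : orderOf t ∣ 4 := hcard P ▸ (P : Subgroup G).orderOf_dvd_natCard ht
      have := Nat.le_of_dvd (by norm_num) hd
      have := h4 t
      have : orderOf t ≠ 1 := by simpa using h1
      interval_cases orderOf t <;> simp_all
    refine ⟨ho, Subgroup.eq_of_le_of_card_ge (fun g hg ↦ ?_) ((hcent t ho).trans (hcard P).ge)⟩
    have hc := (IsPGroup.isMulCommutative_of_card_eq_prime_sq (p := 2) (hcard P)).is_comm.comm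
      ⟨g, hg⟩ ⟨t, ht⟩
    rw [Subgroup.mem_centralizer_singleton_iff]
    exact congrArg Subtype.val hc
  let f : (Σ P : Sylow 2 G, {x : P // x ≠ 1}) → {t : G | orderOf t = 2} := fun x ↦
    ⟨x.2.1, (key x.1 x.2.1 x.2.1.2 (by simpa using x.2.2)).1⟩
  have hf : Function.Bijective f := by
    constructor
    · rintro ⟨P, ⟨x, hxP⟩, hx⟩ ⟨Q, ⟨y, hyQ⟩, hy⟩ h
      obtain rfl : x = y := congrArg Subtype.val h
      have hx' : x ≠ 1 := fun h ↦ hx (Subtype.ext h)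
      obtain rfl : P = Q := Sylow.ext ((key P x hxP hx').2.trans (key Q x hyQ hx').2.symm)
      rfl
    · rintro ⟨t, ht⟩
      have hp : IsPGroup 2 (Subgroup.zpowers t) := IsPGroup.of_card (n := 1) (by
        rw [Nat.card_zpowers]; exact ht)
      obtain ⟨P, hP⟩ := hp.exists_le_sylow
      have h1 : t ≠ 1 := by rintro rfl; simp at ht
      exact ⟨⟨P, ⟨t, hP (Subgroup.mem_zpowers t)⟩, fun h ↦ h1 (congrArg Subtype.val h)⟩, rfl⟩
  have := Fintype.ofFinite (Sylow 2 G)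
  rw [← Nat.card_coe_set_eq, ← Nat.card_congr (Equiv.ofBijective f hf), Nat.card_sigma,
    Finset.sum_congr rfl (g := fun _ ↦ 3)]
  · simp
  · intro P _
    have h := Set.ncard_add_ncard_compl ({1} : Set P)
    rw [Set.ncard_singleton, hcard P] at h
    rw [← Set.coe_ofPred, Nat.card_coe_set_eq]
    change ({1} : Set P)ᶜ.ncard = 3
    omega

lemma nonempty_mulEquiv_alternatingGroup_five [Finite G] (hG : Nat.card G = 60)
    (hn : ∀ H : Subgroup G, H.Normal → ¬ (Nat.card H).Prime)
    (h4 : ∀ g : G, orderOf g ≠ 4)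
    (hcent : ∀ t : G, orderOf t = 2 → Nat.card (Subgroup.centralizer {t}) ≤ 4)
    (hconj : ∀ t u : G, orderOf t = 2 → orderOf u = 2 → IsConj t u) :
    Nonempty (G ≃* alternatingGroup (Fin 5)) := by
  have hcard (P : Sylow 2 G) : Nat.card P = 4 :=
    card_sylow_eq_pow (k := 2) (m := 15) P hG (by norm_num)
  obtain ⟨t, ht⟩ := exists_prime_orderOf_dvd_card' (G := G) 2 (by rw [hG]; norm_num)
  have hinv : conjugatesOf t = {t : G | orderOf t = 2} := by
    ext u
    refine ⟨fun h ↦ ?_, fun hu ↦ hconj t u ht hu⟩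
    obtain ⟨g, rfl⟩ := isConj_iff.mp h
    exact ((MulAut.conj g).orderOf_eq t).trans ht
  have h3 := card_sylow_two_mul_three hcard h4 hcent
  have h60 := ncard_conjugatesOf_mul_card_centralizer t
  rw [hinv, ← h3, hG] at h60
  have hodd := card_sylow_modEq_one 2 G
  have h5 : Nat.card (Sylow 2 G) = 5 := by
    have hle := hcent t ht
    generalize Nat.card (Subgroup.centralizer {t}) = c at h60 hle
    rw [Nat.ModEq] at hodd
    interval_cases c <;> omega
  have hk := card_ker_toPermHom_sylow_dvd (G := G) (p := 2)
  rw [h5, hG] at hk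
  have hk12 : Nat.card (MulAction.toPermHom G (Sylow 2 G)).ker ∣ 12 :=
    Nat.dvd_of_mul_dvd_mul_right (k := 5) (by norm_num) hk
  have hk2 : ¬ 2 ∣ Nat.card (MulAction.toPermHom G (Sylow 2 G)).ker := by
    intro hdvd
    obtain ⟨k, hk⟩ := exists_prime_orderOf_dvd_card' 2 hdvd
    have hsub : {t : G | orderOf t = 2} ⊆ (MulAction.toPermHom G (Sylow 2 G)).ker := by
      intro u hu
      obtain ⟨g, rfl⟩ := isConj_iff.mp (hconj k u ((Subgroup.orderOf_coe k).trans hk) hu)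
      exact Subgroup.Normal.conj_mem inferInstance _ k.2 g
    have hle := Set.ncard_le_ncard hsub
    have := Nat.le_of_dvd (by norm_num) hk12
    rw [← h3, h5, ← Nat.card_coe_set_eq, SetLike.coe_sort_coe] at hle
    omega
  have hinj : Function.Injective (MulAction.toPermHom G (Sylow 2 G)) := by
    have h2 := hn _ (MulAction.toPermHom G (Sylow 2 G)).normal_ker
    rw [← MonoidHom.ker_eq_bot_iff, ← Subgroup.card_eq_one]
    generalize Nat.card (MulAction.toPermHom G (Sylow 2 G)).ker = k at h2 hk2 hk12
    have := Nat.le_of_dvd (by norm_num) hk12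
    interval_cases k <;> simp_all +decide
  exact nonempty_mulEquiv_alternatingGroup_of_injective hinj h5 (by rw [hG]; rfl)

end Recognition

section TwoFixedPoints

open MulAction

variable {G X : Type*} [Group G] [MulAction G X] [Finite G]

lemma card_centralizer_le_two_mul_card_stabilizer
    (hfix : ∀ g : G, g ≠ 1 → (fixedBy X g).ncard = 2) {t : G} (ht : t ≠ 1) {x : X}
    (hx : t • x = x) :
    Nat.card (Subgroup.centralizer {t}) ≤ 2 * Nat.card (stabilizer G x) := by
  rw [← (stabilizer (Subgroup.centralizer {t}) x).index_mul_card, index_stabilizer]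
  refine Nat.mul_le_mul ?_ ?_
  · rw [← hfix t ht]
    refine Set.ncard_le_ncard ?_ (Set.finite_of_ncard_ne_zero (by simp [hfix t ht]))
    rintro _ ⟨g, rfl⟩
    have hg := Subgroup.mem_centralizer_singleton_iff.mp g.2
    change t • (g : G) • x = (g : G) • x
    rw [← mul_smul, ← hg, mul_smul, hx]
  · exact Nat.card_le_card_of_injective
      (fun g ↦ (⟨g.1, g.2⟩ : stabilizer G x)) fun g h hgh ↦
        Subtype.ext (Subtype.ext (congrArg (fun k : stabilizer G x ↦ (k : G)) hgh))

/-- A finite group acting with cyclic stabilizers, in such a way that every nontrivial element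
has exactly two fixed points, is cyclic, dihedral or polyhedral. -/
theorem classification_of_ncard_fixedBy_eq_two
    (hfix : ∀ g : G, g ≠ 1 → (fixedBy X g).ncard = 2)
    (hcyc : ∀ x : X, IsCyclic (stabilizer G x)) :
    (∃ n : ℕ, Nonempty (G ≃* Multiplicative (ZMod n))) ∨
    (∃ n : ℕ, Nonempty (G ≃* DihedralGroup n)) ∨
    Nonempty (G ≃* alternatingGroup (Fin 4)) ∨
    Nonempty (G ≃* Equiv.Perm (Fin 4)) ∨
    Nonempty (G ≃* alternatingGroup (Fin 5)) := by
  have of_isCyclic (h : IsCyclic G) : ∃ n : ℕ, Nonempty (G ≃* Multiplicative (ZMod n)) :=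
    ⟨_, ⟨(zmodCyclicMulEquiv h).symm⟩⟩
  rcases subsingleton_or_nontrivial G with hG | hG
  · exact .inl (of_isCyclic inferInstance)
  have hexists (g : G) (hg : g ≠ 1) : ∃ w : X, g ∈ stabilizer G w ∧ stabilizer G w ≠ ⊥ := by
    obtain ⟨w, hw⟩ : (fixedBy X g).Nonempty :=
      Set.nonempty_of_ncard_ne_zero (by simp [hfix g hg])
    exact ⟨w, hw, mem_nonfreePoints.mpr ⟨g, hg, hw⟩⟩
  rcases exists_stabilizer_eq_top_or_platonic hfix with ⟨x, hx⟩ | ⟨x, y, z, hcov, hx, h⟩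
  · have := hcyc x
    rw [hx] at this
    exact .inl (of_isCyclic (Subgroup.topEquiv.isCyclic.mp this))
  have hcov' (w : X) (hw : stabilizer G w ≠ ⊥) : Nat.card (stabilizer G w) = 2 ∨
      Nat.card (stabilizer G w) = Nat.card (stabilizer G y) ∨
      Nat.card (stabilizer G w) = Nat.card (stabilizer G z) :=
    (hcov w hw).imp (fun h ↦ (card_stabilizer_eq_of_mem_orbit h).trans hx)
      (Or.imp card_stabilizer_eq_of_mem_orbit card_stabilizer_eq_of_mem_orbit)
  have hno (hG : 12 ≤ Nat.card G) (hy : Nat.card (stabilizer G y) ≤ 5)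
      (hz : Nat.card (stabilizer G z) ≤ 5) (H : Subgroup G) (_ : H.Normal) :
      ¬ (Nat.card H).Prime := by
    intro hp
    obtain ⟨w, hw⟩ := exists_card_le_two_mul_card_stabilizer hfix H hp
    have := hcov' w fun h ↦ by rw [h, Subgroup.card_bot] at hw; omega
    omega
  rcases h with ⟨hy, hz⟩ | ⟨hy, hz, hG⟩ | ⟨hy, hz, hG⟩ | ⟨hy, hz, hG⟩
  · refine .inr (.inl ⟨_, nonempty_mulEquiv_dihedralGroup _ (hcyc z) hz fun g hg ↦ ?_⟩)
    obtain ⟨w, hgw, hw⟩ := hexists g fun h ↦ hg (h ▸ one_mem _)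
    have of_card (h : Nat.card (stabilizer G w) = 2) : g * g = 1 := by
      rw [← pow_two, ← orderOf_dvd_iff_pow_eq_one, ← h]
      exact Subgroup.orderOf_dvd_natCard _ hgw
    rcases hcov w hw with h | h | ⟨k, rfl⟩
    · exact of_card ((card_stabilizer_eq_of_mem_orbit h).trans hx)
    · exact of_card ((card_stabilizer_eq_of_mem_orbit h).trans hy)
    · have hindex : (stabilizer G z).index = 2 := by
        have h1 := (stabilizer G z).index_mul_card
        rw [hz] at h1
        exact Nat.eq_of_mul_eq_mul_right Nat.card_pos h1
      have := Subgroup.normal_of_index_eq_two hindex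
      simp only [stabilizer_smul_eq_stabilizer_map_conj] at hgw
      obtain ⟨l, hl, rfl⟩ := hgw
      exact absurd (this.conj_mem l hl k) hg
  · exact .inr (.inr (.inl (nonempty_mulEquiv_alternatingGroup_four hG
      (hno (by omega) (by omega) (by omega)))))
  · exact .inr (.inr (.inr (.inl (nonempty_mulEquiv_perm_four hG
      (hno (by omega) (by omega) (by omega))))))
  · refine .inr (.inr (.inr (.inr (nonempty_mulEquiv_alternatingGroup_five hG
      (hno (by omega) (by omega) (by omega)) (fun g hg ↦ ?_) (fun t ht ↦ ?_)
      fun t u ht hu ↦ ?_))))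
    · obtain ⟨w, hgw, hw⟩ := hexists g (by rintro rfl; simp at hg)
      have h1 := Subgroup.orderOf_dvd_natCard _ hgw
      have h2 := hcov' w hw
      rw [hg] at h1
      rw [hy, hz] at h2
      rcases h2 with h2 | h2 | h2 <;> rw [h2] at h1 <;> norm_num at h1
    all_goals
      have involution {t : G} (ht : orderOf t = 2) :
          ∃ g : G, ∃ s : stabilizer G x, s ≠ 1 ∧ g * s * g⁻¹ = t := by
        obtain ⟨w, htw, hw⟩ := hexists t (by rintro rfl; simp at ht)
        have h1 := Subgroup.orderOf_dvd_natCard _ htw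
        rw [ht] at h1
        rcases hcov w hw with ⟨g, rfl⟩ | h | h
        · simp only [stabilizer_smul_eq_stabilizer_map_conj] at htw
          obtain ⟨s, hs, rfl⟩ := htw
          refine ⟨g, ⟨s, hs⟩, fun h ↦ ?_, rfl⟩
          obtain rfl : s = 1 := congrArg Subtype.val h
          simp at ht
        · rw [card_stabilizer_eq_of_mem_orbit h, hy] at h1; norm_num at h1
        · rw [card_stabilizer_eq_of_mem_orbit h, hz] at h1; norm_num at h1
    · obtain ⟨g, s, hs, rfl⟩ := involution ht
      have h := card_centralizer_le_two_mul_card_stabilizer hfix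
        (t := g * s * g⁻¹) (x := g • x) (by rintro h; simp [h] at ht)
        (by simp [mul_smul, mem_stabilizer_iff.mp s.2])
      rwa [card_stabilizer_eq_of_mem_orbit (mem_orbit x g), hx] at h
    · obtain ⟨g, s, hs, rfl⟩ := involution ht
      obtain ⟨h, s', hs', rfl⟩ := involution hu
      obtain rfl : s = s' := ((Nat.card_eq_two_iff' 1).mp hx).unique hs hs'
      exact (isConj_iff.mpr ⟨g, rfl⟩).symm.trans (isConj_iff.mpr ⟨h, rfl⟩)

end TwoFixedPoints

open scoped MatrixGroups in
/-- A finite subgroup of `PGL(2, ℂ)` is cyclic, dihedral or polyhedral. -/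
theorem classification_of_subgroup_projGenLinGroup (G : Subgroup PGL(2, ℂ)) [Finite G] :
    (∃ n : ℕ, Nonempty (G ≃* Multiplicative (ZMod n))) ∨
    (∃ n : ℕ, Nonempty (G ≃* DihedralGroup n)) ∨
    Nonempty (G ≃* alternatingGroup (Fin 4)) ∨
    Nonempty (G ≃* Equiv.Perm (Fin 4)) ∨
    Nonempty (G ≃* alternatingGroup (Fin 5)) :=
  classification_of_ncard_fixedBy_eq_two
    (fun g hg ↦ ncard_fixedBy_projectivization (p := g)
      (G.subtype.isOfFinOrder (isOfFinOrder_of_finite g)) (by simpa using hg))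
    (isCyclic_stabilizer_projectivization G)

/-- Classification of the finite subgroups of `PGL(2, ℂ) = GL(2, ℂ)/center`: every finite
subgroup is isomorphic to a cyclic group `ℤ/n`, a dihedral group of order `2n`, `A₄`,
`S₄`, or `A₅`. -/
theorem finite_subgroups_of_PGL2C
    (G : Subgroup (GL (Fin 2) ℂ ⧸ Subgroup.center (GL (Fin 2) ℂ))) [Finite G] :
    (∃ n : ℕ, Nonempty (G ≃* Multiplicative (ZMod n))) ∨
    (∃ n : ℕ, Nonempty (G ≃* DihedralGroup n)) ∨
    Nonempty (G ≃* alternatingGroup (Fin 4)) ∨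
    Nonempty (G ≃* Equiv.Perm (Fin 4)) ∨
    Nonempty (G ≃* alternatingGroup (Fin 5)) :=
  @classification_of_subgroup_projGenLinGroup G (show Finite G from inferInstance)
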